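/- Let h^s and h^d be host label codes with distance k = max{ i : h^s_i ≠ h^d_i }. Then for every choice of up-ports (p_1, …, p_{k−1}) ∈ Z_d^{k−1}, the layer-k switch t = (p_1, …, p_{k−1}, h^s_{k+1}, …, h^s_ℓ) reached from h^s via these ports satisfies t_j = h^d_{j+1} for all j with k ≤ j ≤ ℓ−1; hence every up-port sequence in Z_d^{k−1} leads to a transition switch from which a downward path to h^d exists (upward routing is fully adaptive). -/

import Mathlib

/-- A host label code in the fat-tree `F(ℓ, d)`: the top coordinate `h_ℓ`
(0-based index `ℓ-1`) lies in `Z_{2d}` and all other coordinates lie in `Z_d`.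
The 0-based index `i` corresponds to the 1-based coordinate `i+1`. -/
def IsHostCode (d ℓ : ℕ) (h : Fin ℓ → ℕ) : Prop :=
  ∀ i : Fin ℓ, if (i : ℕ) = ℓ - 1 then h i < 2 * d else h i < d

/-- A layer-`(m-1)` switch `x` and a layer-`m` switch `y` (`2 ≤ m ≤ ℓ`) are connected
iff they agree in all coordinates except the `(m-1)`-th (0-based index `m-2`). -/
def ConnectedAt (ℓ m : ℕ) (x y : Fin (ℓ - 1) → ℕ) : Prop :=
  ∀ i : Fin (ℓ - 1), (i : ℕ) ≠ m - 2 → x i = y i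

/-- The host `h` is attached to the layer-1 switch `(h_ℓ, …, h_2)`. -/
def AttachedTo (ℓ : ℕ) (s : Fin (ℓ - 1) → ℕ) (h : Fin ℓ → ℕ) : Prop :=
  ∀ i : Fin (ℓ - 1), s i = h ⟨(i : ℕ) + 1, by have := i.isLt; omega⟩

/-- A downward path from the layer-`k` switch `t` to the host `u`. -/
def IsDownPath (ℓ k : ℕ) (t : Fin (ℓ - 1) → ℕ) (u : Fin ℓ → ℕ)
    (w : ℕ → Fin (ℓ - 1) → ℕ) : Prop :=
  w k = t ∧ (∀ j, 2 ≤ j → j ≤ k → ConnectedAt ℓ j (w (j - 1)) (w j)) ∧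
    AttachedTo ℓ (w 1) u

/-- If the coordinates of the layer-`k` switch `t` from the `k`-th on agree with those of the
host `u`, then replacing the remaining coordinates one layer at a time leads down to `u`. -/
theorem exists_isDownPath {ℓ k : ℕ} {t : Fin (ℓ - 1) → ℕ} {u : Fin ℓ → ℕ}
    (h : ∀ i : Fin (ℓ - 1), k ≤ (i : ℕ) + 1 →
      t i = u ⟨(i : ℕ) + 1, by have := i.isLt; omega⟩) :
    ∃ w, IsDownPath ℓ k t u w := by
  refine ⟨fun m i => if (i : ℕ) + 1 < m then t i
    else u ⟨(i : ℕ) + 1, by have := i.isLt; omega⟩, ?_, ?_, ?_⟩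
  · funext i
    dsimp only
    split_ifs with hi
    · rfl
    · exact (h i (by omega)).symm
  · intro j hj _ i hi
    have hiff : (i : ℕ) + 1 < j - 1 ↔ (i : ℕ) + 1 < j := by omega
    simp only [hiff]
  · intro i
    simp

/-- Let `hs, hdst` be host label codes with distance `k = max{i : hs_i ≠ hdst_i}`
(i.e. `hs_k ≠ hdst_k` and `hs_i = hdst_i` for every 1-based coordinate `i > k`).
Then for every choice of up-ports `(p_1, …, p_{k-1}) ∈ Z_d^{k-1}`, the layer-`k`
switch `t = (p_1, …, p_{k-1}, hs_{k+1}, …, hs_ℓ)` reached from `hs` via these ports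
satisfies `t_j = hdst_{j+1}` for all `k ≤ j ≤ ℓ-1`; hence a downward path from the
transition switch `t` to `hdst` exists: upward routing is fully adaptive. -/
theorem fully_adaptive_upward (d ℓ : ℕ) (hd : 1 ≤ d) (hℓ : 2 ≤ ℓ)
    (hs hdst : Fin ℓ → ℕ) (hhs : IsHostCode d ℓ hs) (hhd : IsHostCode d ℓ hdst)
    (k : ℕ) (hk1 : 1 ≤ k) (hk2 : k ≤ ℓ)
    (hdiff : hs ⟨k - 1, by omega⟩ ≠ hdst ⟨k - 1, by omega⟩)
    (habove : ∀ i : Fin ℓ, k ≤ (i : ℕ) → hs i = hdst i)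
    (p : ℕ → ℕ) (hp : ∀ m, 1 ≤ m → m ≤ k - 1 → p m < d) :
    ∀ t : Fin (ℓ - 1) → ℕ,
      (∀ j : Fin (ℓ - 1),
          t j = if (j : ℕ) < k - 1 then p ((j : ℕ) + 1)
                else hs ⟨(j : ℕ) + 1, by have := j.isLt; omega⟩) →
      (∀ j (_ : k ≤ j) (_ : j ≤ ℓ - 1),
          t ⟨j - 1, by omega⟩ = hdst ⟨j, by omega⟩) ∧
      ∃ w, IsDownPath ℓ k t hdst w := by
  intro t ht
  have hagree : ∀ i : Fin (ℓ - 1), k ≤ (i : ℕ) + 1 →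
      t i = hdst ⟨(i : ℕ) + 1, by have := i.isLt; omega⟩ := by
    intro i hi
    rw [ht i, if_neg (by omega)]
    exact habove _ hi
  refine ⟨fun j hkj hj => ?_, exists_isDownPath hagree⟩
  obtain ⟨n, rfl⟩ : ∃ n, j = n + 1 := ⟨j - 1, by omega⟩
  exact hagree ⟨n, by omega⟩ hkj
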